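/- Let Y, A be {0,1}-valued random variables, X a random variable in a measurable space, R a version of E[Y | σ(X,A)], and ℓ : {0,1}×{0,1} → ℝ a loss function. Then the infimum of E[ℓ(Ŷ, Y)] over all randomized predictors Ŷ based on (X, A) satisfying equalized odds equals the infimum of E[ℓ(Y*, Y)] over all predictors Y* derived from (R, A) satisfying equalized odds; hence an optimal equalized odds predictor can be derived from the Bayes optimal regressor R and the protected attribute A. The same holds with equalized odds replaced by equal opportunity. -/

import Mathlib

open MeasureTheory ProbabilityTheory
open scoped ENNReal

/-- The σ-algebra generated by a pair of random variables. -/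
def pairSigma {Ω β γ : Type*} [MeasurableSpace β] [MeasurableSpace γ]
    (X : Ω → β) (A : Ω → γ) : MeasurableSpace Ω :=
  MeasurableSpace.comap (fun ω => (X ω, A ω)) inferInstance

/-- Clipping to the unit interval. -/
noncomputable def clipU (r : ℝ) : ℝ := max 0 (min r 1)

lemma clipU_mem (r : ℝ) : clipU r ∈ Set.Icc (0:ℝ) 1 := by
  unfold clipU; constructor
  · exact le_max_left _ _
  · exact max_le zero_le_one (min_le_right _ _)

lemma clipU_eq {r : ℝ} (h0 : 0 ≤ r) (h1 : r ≤ 1) : clipU r = r := by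
  unfold clipU; rw [min_eq_left h1, max_eq_right h0]

lemma measurable_clipU : Measurable clipU := by
  unfold clipU; fun_prop

lemma integrable_of_bdd_one {Ω : Type*} [MeasurableSpace Ω] {μ : Measure Ω} [IsFiniteMeasure μ]
    {f : Ω → ℝ} (hf : Measurable f) (hb : ∀ z, |f z| ≤ 1) : Integrable f μ :=
  Integrable.of_bound hf.aestronglyMeasurable 1 (Filter.Eventually.of_forall hb)

lemma abs_le_one_of_mem {x : ℝ} (h : x ∈ Set.Icc (0:ℝ) 1) : |x| ≤ 1 :=
  abs_le.2 ⟨by linarith [h.1], h.2⟩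

lemma abs_mul_le_one' {x y : ℝ} (hx : |x| ≤ 1) (hy : |y| ≤ 1) : |x * y| ≤ 1 := by
  rw [abs_mul]; exact mul_le_one₀ hx (abs_nonneg _) hy

/-- The moment set of `[0,1]`-valued functions is compact. -/
lemma isCompact_moments {Z ι : Type*} [MeasurableSpace Z] (ν : Measure Z) [IsProbabilityMeasure ν]
    (W : ι → Z → ℝ) (hW : ∀ i, Measurable (W i)) (hb : ∀ i z, |W i z| ≤ 1) :
    IsCompact {v : ι → ℝ | ∃ g : Z → ℝ, Measurable g ∧ (∀ z, g z ∈ Set.Icc (0:ℝ) 1) ∧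
      ∀ i, v i = ∫ z, g z * W i z ∂ν} := by
  have hWm : ∀ i, MemLp (W i) 2 ν := fun i =>
    MemLp.of_bound (hW i).aestronglyMeasurable 1 (Filter.Eventually.of_forall (hb i))
  let w : ι → Lp ℝ 2 ν := fun i => (hWm i).toLp
  let S : Set (WeakDual ℝ (Lp ℝ 2 ν)) :=
    (WeakDual.toStrongDual ⁻¹' Metric.closedBall 0 1) ∩
      {φ | ∀ (E : Set Z) (hE : MeasurableSet E),
        φ (indicatorConstLp 2 hE (measure_ne_top ν E) (1:ℝ)) ∈ Set.Icc 0 (ν.real E)}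
  have hS : IsCompact S := by
    refine (WeakDual.isCompact_closedBall 0 1).inter_right ?_
    simp only [Set.ofPred_forall]
    refine isClosed_iInter fun E => isClosed_iInter fun hE => ?_
    exact isClosed_Icc.preimage (WeakDual.eval_continuous _)
  have hcont : Continuous (fun (φ : WeakDual ℝ (Lp ℝ 2 ν)) (i : ι) => φ (w i)) :=
    continuous_pi fun i => WeakDual.eval_continuous _
  convert hS.image hcont using 1
  ext v
  constructor
  · rintro ⟨g, hg, hg01, hv⟩
    have hgm : MemLp g 2 ν := MemLp.of_bound hg.aestronglyMeasurable 1
      (Filter.Eventually.of_forall fun z => abs_le_one_of_mem (hg01 z))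
    refine ⟨StrongDual.toWeakDual (InnerProductSpace.toDual ℝ _ hgm.toLp), ⟨?_, ?_⟩, ?_⟩
    · have h1 : ‖hgm.toLp‖ ≤ 1 := by
        have := Lp.norm_le_of_ae_bound (f := hgm.toLp) (C := 1) zero_le_one (by
          filter_upwards [hgm.coeFn_toLp] with z hz
          rw [hz]; exact abs_le_one_of_mem (hg01 z))
        simpa [measureUnivNNReal] using this
      simp only [Set.mem_preimage, mem_closedBall_zero_iff]
      change ‖InnerProductSpace.toDual ℝ _ hgm.toLp‖ ≤ 1
      simpa using h1
    · intro E hE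
      change (InnerProductSpace.toDual ℝ _ hgm.toLp) _ ∈ _
      rw [InnerProductSpace.toDual_apply_apply, real_inner_comm, L2.inner_indicatorConstLp_one]
      rw [setIntegral_congr_ae (g := g) hE (by
        filter_upwards [hgm.coeFn_toLp] with z hz _ using hz)]
      have hi : Integrable g ν := integrable_of_bdd_one hg fun z => abs_le_one_of_mem (hg01 z)
      refine ⟨integral_nonneg fun z => (hg01 z).1, ?_⟩
      calc ∫ z in E, g z ∂ν ≤ ∫ z in E, (1:ℝ) ∂ν :=
            integral_mono hi.integrableOn (integrable_const _) fun z => (hg01 z).2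
        _ = _ := by simp
    · ext i
      change (InnerProductSpace.toDual ℝ _ hgm.toLp) (w i) = _
      rw [InnerProductSpace.toDual_apply_apply, L2.inner_def, hv i]
      refine integral_congr_ae ?_
      filter_upwards [hgm.coeFn_toLp, (hWm i).coeFn_toLp] with z h1 h2
      simp only [w, h1, h2, RCLike.inner_apply, conj_trivial]
      ring
  · rintro ⟨φ, ⟨-, hφ⟩, rfl⟩
    let G : Lp ℝ 2 ν := (InnerProductSpace.toDual ℝ _).symm (WeakDual.toStrongDual φ)
    have hG : ∀ h : Lp ℝ 2 ν, φ h = inner ℝ G h := fun h =>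
      (InnerProductSpace.toDual_symm_apply (y := WeakDual.toStrongDual φ)).symm
    have hGi : Integrable G ν := (Lp.memLp G).integrable (by norm_num)
    have hE : ∀ E : Set Z, MeasurableSet E → ∫ z in E, G z ∂ν ∈ Set.Icc 0 (ν.real E) := by
      intro E hE
      have := hφ E hE
      rwa [hG, real_inner_comm, L2.inner_indicatorConstLp_one] at this
    have h0 : 0 ≤ᵐ[ν] G := ae_nonneg_of_forall_setIntegral_nonneg hGi fun s hs _ => (hE s hs).1
    have h1 : G ≤ᵐ[ν] fun _ => (1:ℝ) :=
      ae_le_of_forall_setIntegral_le hGi (integrable_const _) fun s hs _ => by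
        simpa using (hE s hs).2
    refine ⟨fun z => clipU (G z), measurable_clipU.comp (Lp.stronglyMeasurable G).measurable,
      fun z => clipU_mem _, fun i => ?_⟩
    change φ (w i) = _
    rw [hG, L2.inner_def]
    refine integral_congr_ae ?_
    filter_upwards [h0, h1, (hWm i).coeFn_toLp] with z h0 h1 h2
    simp only [w, h2, RCLike.inner_apply, conj_trivial]
    rw [clipU_eq h0 h1]
    ring

/-- Projection of a predictor onto a coarser sigma-algebra. -/
lemma exists_projection {Ω Z : Type*} [mΩ : MeasurableSpace Ω] [MeasurableSpace Z]
    (μ : Measure Ω) [IsProbabilityMeasure μ] (T : Ω → Z) (hT : Measurable T)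
    (p : Ω → ℝ) (hp : Measurable p) (hp01 : ∀ ω, p ω ∈ Set.Icc (0:ℝ) 1) :
    ∃ g : Z → ℝ, Measurable g ∧ (∀ z, g z ∈ Set.Icc (0:ℝ) 1) ∧
      ∀ W : Z → ℝ, Measurable W → (∀ z, |W z| ≤ 1) →
        ∫ ω, p ω * W (T ω) ∂μ = ∫ ω, g (T ω) * W (T ω) ∂μ := by
  have hpi : Integrable p μ := integrable_of_bdd_one hp fun z => abs_le_one_of_mem (hp01 z)
  have hpw' : ∀ W : Z → ℝ, Measurable W → (∀ z, |W z| ≤ 1) →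
      Integrable (p * fun ω => W (T ω)) μ := fun W hW hb =>
    integrable_of_bdd_one (hp.mul (hW.comp hT))
      fun z => abs_mul_le_one' (abs_le_one_of_mem (hp01 z)) (hb _)
  let m : MeasurableSpace Ω := MeasurableSpace.comap T inferInstance
  have hm : m ≤ mΩ := hT.comap_le
  have hmeas : Measurable[m] (μ[p | m]) := stronglyMeasurable_condExp.measurable
  obtain ⟨g, hg, hgeq⟩ := hmeas.exists_eq_measurable_comp
  have h0 : 0 ≤ᵐ[μ] μ[p | m] := condExp_nonneg (Filter.Eventually.of_forall fun ω => (hp01 ω).1)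
  have h1 : μ[p | m] ≤ᵐ[μ] fun _ => (1:ℝ) := by
    have := condExp_mono (m := m) hpi (integrable_const (1:ℝ))
      (Filter.Eventually.of_forall fun ω => (hp01 ω).2)
    rwa [condExp_const hm] at this
  refine ⟨fun z => clipU (g z), measurable_clipU.comp hg, fun z => clipU_mem _, ?_⟩
  intro W hW hb
  have hWT : Measurable[m] (fun ω => W (T ω)) := hW.comp (comap_measurable T)
  have hpw := hpw' W hW hb
  have h2 := condExp_mul_of_stronglyMeasurable_right hWT.stronglyMeasurable hpw hpi
  have h3 : ∫ ω, p ω * W (T ω) ∂μ = ∫ ω, (μ[p * fun ω => W (T ω) | m]) ω ∂μ :=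
    (integral_condExp hm).symm
  rw [h3]
  refine integral_congr_ae ?_
  filter_upwards [h0, h1, h2] with ω a0 a1 a2
  rw [a2, Pi.mul_apply]
  rw [hgeq] at a0 a1 ⊢
  simp only [Function.comp] at a0 a1 ⊢
  rw [clipU_eq a0 a1]

/-- Weight function of the cell `A = a, Y = y`. -/
noncomputable def cellW (a y : Bool) (z : ℝ × Bool) : ℝ :=
  if z.2 = a then (if y then clipU z.1 else 1 - clipU z.1) else 0

lemma measurable_cellW (a y : Bool) : Measurable (cellW a y) := by
  unfold cellW
  refine Measurable.ite (measurable_snd (measurableSet_singleton a)) ?_ measurable_const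
  have := measurable_clipU
  cases y <;> simp <;> fun_prop

lemma abs_cellW_le (a y : Bool) (z) : |cellW a y z| ≤ 1 := by
  have := clipU_mem z.1
  apply abs_le_one_of_mem
  unfold cellW
  split_ifs
  · exact this
  · exact ⟨by linarith [this.2], by linarith [this.1]⟩
  · simp

lemma cell_integral {Ω : Type*} (m : MeasurableSpace Ω) [mΩ : MeasurableSpace Ω]
    (μ : Measure Ω) [IsProbabilityMeasure μ] (hm : m ≤ mΩ)
    (Y : Ω → Bool) (A : Ω → Bool) (R : Ω → ℝ)
    (hY : Measurable Y) (hA : Measurable[m] A) (hRm : Measurable[m] R)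
    (hR : R =ᵐ[μ] μ[fun ω => if Y ω then (1:ℝ) else 0 | m])
    (p : Ω → ℝ) (hp : Measurable[m] p) (hp01 : ∀ ω, p ω ∈ Set.Icc (0:ℝ) 1) (a y : Bool) :
    ∫ ω in {ω | A ω = a ∧ Y ω = y}, p ω ∂μ = ∫ ω, p ω * cellW a y (R ω, A ω) ∂μ := by
  let q : Ω → ℝ := fun ω => if Y ω then (1:ℝ) else 0
  let u : Ω → ℝ := fun ω => if A ω = a then p ω else 0
  have hq : Measurable q :=
    Measurable.ite (hY (measurableSet_singleton true)) measurable_const measurable_const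
  have hq01 : ∀ ω, q ω ∈ Set.Icc (0:ℝ) 1 := fun ω => by simp only [q]; split_ifs <;> simp
  have hum : Measurable[m] u :=
    Measurable.ite (hA (measurableSet_singleton a)) hp measurable_const
  have hu : Measurable u := hum.mono hm le_rfl
  have hA' : Measurable A := hA.mono hm le_rfl
  have hu01 : ∀ ω, u ω ∈ Set.Icc (0:ℝ) 1 := fun ω => by
    simp only [u]; split_ifs
    · exact hp01 ω
    · simp
  have hqi : Integrable q μ := integrable_of_bdd_one hq fun z => abs_le_one_of_mem (hq01 z)
  have hui : Integrable u μ := integrable_of_bdd_one hu fun z => abs_le_one_of_mem (hu01 z)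
  have huq : Integrable (u * q) μ := integrable_of_bdd_one (hu.mul hq)
      fun z => abs_mul_le_one' (abs_le_one_of_mem (hu01 z)) (abs_le_one_of_mem (hq01 z))
  have huc : Integrable (fun ω => u ω * clipU (R ω)) μ :=
    integrable_of_bdd_one (hu.mul (measurable_clipU.comp (hRm.mono hm le_rfl)))
      fun z => abs_mul_le_one' (abs_le_one_of_mem (hu01 z)) (abs_le_one_of_mem (clipU_mem _))
  have h0 : 0 ≤ᵐ[μ] μ[q | m] := condExp_nonneg (Filter.Eventually.of_forall fun ω => (hq01 ω).1)
  have h1 : μ[q | m] ≤ᵐ[μ] fun _ => (1:ℝ) := by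
    have := condExp_mono (m := m) hqi (integrable_const (1:ℝ))
      (Filter.Eventually.of_forall fun ω => (hq01 ω).2)
    rwa [condExp_const hm] at this
  have h2 := condExp_mul_of_stronglyMeasurable_left hum.stronglyMeasurable huq hqi
  have key : ∫ ω, u ω * q ω ∂μ = ∫ ω, u ω * clipU (R ω) ∂μ := by
    have h3 : ∫ ω, u ω * q ω ∂μ = ∫ ω, (μ[u * q | m]) ω ∂μ := (integral_condExp hm).symm
    rw [h3]
    refine integral_congr_ae ?_
    filter_upwards [h0, h1, h2, hR] with ω a0 a1 a2 a3
    rw [a2, Pi.mul_apply, a3, clipU_eq a0 a1]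
  have hS : MeasurableSet {ω | A ω = a ∧ Y ω = y} :=
    (hA' (measurableSet_singleton a)).inter (hY (measurableSet_singleton y))
  rw [← integral_indicator hS]
  cases y
  · have e1 : ∀ ω, Set.indicator {ω | A ω = a ∧ Y ω = false} p ω = u ω - u ω * q ω := by
      intro ω
      by_cases h : A ω = a <;> cases h' : Y ω <;> simp [Set.indicator, u, q, h, h']
    have e2 : ∀ ω, p ω * cellW a false (R ω, A ω) = u ω - u ω * clipU (R ω) := by
      intro ω
      by_cases h : A ω = a <;> simp [cellW, u, h]
      ring
    simp_rw [e1, e2]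
    have huq2 : Integrable (fun ω => u ω * q ω) μ := huq
    rw [integral_sub hui huq2, integral_sub hui huc, key]
  · have e1 : ∀ ω, Set.indicator {ω | A ω = a ∧ Y ω = true} p ω = u ω * q ω := by
      intro ω
      by_cases h : A ω = a <;> cases h' : Y ω <;> simp [Set.indicator, u, q, h, h']
    have e2 : ∀ ω, p ω * cellW a true (R ω, A ω) = u ω * clipU (R ω) := by
      intro ω
      by_cases h : A ω = a <;> simp [cellW, u, h]
    simp_rw [e1, e2]
    exact key

lemma loss_eq {Ω : Type*} [mΩ : MeasurableSpace Ω]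
    (μ : Measure Ω) [IsProbabilityMeasure μ] (Y A : Ω → Bool)
    (hY : Measurable Y) (hA : Measurable A) (L : Bool → Bool → ℝ)
    (p : Ω → ℝ) (hp : Measurable p) (hp01 : ∀ ω, p ω ∈ Set.Icc (0:ℝ) 1) :
    ∫ ω, (p ω * L true (Y ω) + (1 - p ω) * L false (Y ω)) ∂μ =
      ∑ i : Bool × Bool, ((L true i.2 - L false i.2) * (∫ ω in {ω | A ω = i.1 ∧ Y ω = i.2}, p ω ∂μ)
        + L false i.2 * μ.real {ω | A ω = i.1 ∧ Y ω = i.2}) := by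
  have hS : ∀ i : Bool × Bool, MeasurableSet {ω | A ω = i.1 ∧ Y ω = i.2} := fun i =>
    (hA (measurableSet_singleton i.1)).inter (hY (measurableSet_singleton i.2))
  have hpi : Integrable p μ := integrable_of_bdd_one hp fun z => abs_le_one_of_mem (hp01 z)
  have e : ∀ ω, p ω * L true (Y ω) + (1 - p ω) * L false (Y ω) =
      ∑ i : Bool × Bool, Set.indicator {ω | A ω = i.1 ∧ Y ω = i.2}
        (fun ω => (L true i.2 - L false i.2) * p ω + L false i.2) ω := by
    intro ω
    rw [Finset.sum_eq_single (A ω, Y ω)]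
    · simp [Set.indicator]; ring
    · rintro ⟨b, y⟩ - hne
      apply Set.indicator_of_notMem
      rintro ⟨h1, h2⟩
      exact hne (by simp_all)
    · simp
  have hi : ∀ i : Bool × Bool, Integrable (fun ω => (L true i.2 - L false i.2) * p ω) μ :=
    fun i => hpi.const_mul _
  simp_rw [e]
  have hI : ∀ i : Bool × Bool, Integrable (Set.indicator {ω | A ω = i.1 ∧ Y ω = i.2}
      (fun ω => (L true i.2 - L false i.2) * p ω + L false i.2)) μ := fun i =>
    ((hi i).add (integrable_const _)).indicator (hS i)
  rw [integral_finsetSum _ fun i _ => hI i]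
  refine Finset.sum_congr rfl fun i _ => ?_
  rw [integral_indicator (hS i), integral_add (hi i).integrableOn (integrable_const _),
    integral_const_mul]
  simp [mul_comm]

/-- General version: constraint and loss are functions of the four cell integrals. -/
lemma general_derived {Ω β : Type*} [mΩ : MeasurableSpace Ω] [MeasurableSpace β]
    (μ : Measure Ω) [IsProbabilityMeasure μ]
    (Y : Ω → Bool) (X : Ω → β) (A : Ω → Bool) (R : Ω → ℝ)
    (hY : Measurable Y) (hX : Measurable X) (hA : Measurable A)
    (hRmeas : Measurable[pairSigma X A] R)
    (hR : R =ᵐ[μ] μ[fun ω => if Y ω then (1:ℝ) else 0 | pairSigma X A])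
    (P : (Ω → ℝ) → Prop) (loss : (Ω → ℝ) → ℝ)
    (C : Set (Bool × Bool → ℝ)) (hC : IsClosed C) (h0C : 0 ∈ C)
    (F : (Bool × Bool → ℝ) → ℝ) (hF : Continuous F)
    (hP : ∀ p, P p ↔
      (fun i : Bool × Bool => ∫ ω in {ω | A ω = i.1 ∧ Y ω = i.2}, p ω ∂μ) ∈ C)
    (hl : ∀ p : Ω → ℝ, Measurable p → (∀ ω, p ω ∈ Set.Icc (0:ℝ) 1) → loss p =
      F (fun i : Bool × Bool => ∫ ω in {ω | A ω = i.1 ∧ Y ω = i.2}, p ω ∂μ)) :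
    (sInf {l : ℝ | ∃ f : β × Bool → ℝ, Measurable f ∧ (∀ z, f z ∈ Set.Icc (0:ℝ) 1) ∧
          P (fun ω => f (X ω, A ω)) ∧ l = loss (fun ω => f (X ω, A ω))} =
        sInf {l : ℝ | ∃ g : ℝ × Bool → ℝ, Measurable g ∧ (∀ z, g z ∈ Set.Icc (0:ℝ) 1) ∧
          P (fun ω => g (R ω, A ω)) ∧ l = loss (fun ω => g (R ω, A ω))}) ∧
      (∃ g : ℝ × Bool → ℝ, Measurable g ∧ (∀ z, g z ∈ Set.Icc (0:ℝ) 1) ∧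
        P (fun ω => g (R ω, A ω)) ∧
        ∀ f : β × Bool → ℝ, Measurable f → (∀ z, f z ∈ Set.Icc (0:ℝ) 1) →
          P (fun ω => f (X ω, A ω)) →
          loss (fun ω => g (R ω, A ω)) ≤ loss (fun ω => f (X ω, A ω))) := by
  have hXA : Measurable (fun ω => (X ω, A ω)) := hX.prodMk hA
  have hm : pairSigma X A ≤ mΩ := hXA.comap_le
  have hXAm : Measurable[pairSigma X A] (fun ω => (X ω, A ω)) := comap_measurable _
  have hAm : Measurable[pairSigma X A] A := measurable_snd.comp hXAm
  have hRA : Measurable (fun ω => (R ω, A ω)) := (hRmeas.mono hm le_rfl).prodMk hA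
  have hRAm : Measurable[pairSigma X A] (fun ω => (R ω, A ω)) := hRmeas.prodMk hAm
  have cell := fun p hp hp01 (i : Bool × Bool) =>
    cell_integral (pairSigma X A) μ hm Y A R hY hAm hRmeas hR p hp hp01 i.1 i.2
  -- projection step
  have proj : ∀ f : β × Bool → ℝ, Measurable f → (∀ z, f z ∈ Set.Icc (0:ℝ) 1) →
      ∃ g : ℝ × Bool → ℝ, Measurable g ∧ (∀ z, g z ∈ Set.Icc (0:ℝ) 1) ∧
        (fun i : Bool × Bool => ∫ ω in {ω | A ω = i.1 ∧ Y ω = i.2}, f (X ω, A ω) ∂μ) =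
        (fun i : Bool × Bool => ∫ ω in {ω | A ω = i.1 ∧ Y ω = i.2}, g (R ω, A ω) ∂μ) := by
    intro f hf hf01
    obtain ⟨g, hg, hg01, h⟩ := exists_projection μ (fun ω => (R ω, A ω)) hRA
      (fun ω => f (X ω, A ω)) (hf.comp hXA) (fun ω => hf01 _)
    refine ⟨g, hg, hg01, ?_⟩
    funext i
    rw [cell (fun ω => f (X ω, A ω)) (hf.comp hXAm) (fun ω => hf01 _) i, cell (fun ω => g (R ω, A ω)) (hg.comp hRAm) (fun ω => hg01 _) i]
    exact h _ (measurable_cellW _ _) (abs_cellW_le _ _)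
  constructor
  · congr 1
    ext l
    constructor
    · rintro ⟨f, hf, hf01, hPf, rfl⟩
      obtain ⟨g, hg, hg01, h⟩ := proj f hf hf01
      refine ⟨g, hg, hg01, ?_, ?_⟩
      · rw [hP] at hPf ⊢; rwa [← h]
      · rw [hl (fun ω => f (X ω, A ω)) (hf.comp hXA) (fun ω => hf01 _), hl (fun ω => g (R ω, A ω)) (hg.comp hRA) (fun ω => hg01 _), h]
    · rintro ⟨g, hg, hg01, hPg, rfl⟩
      obtain ⟨r, hr, hreq⟩ := Measurable.exists_eq_measurable_comp
        (f := fun ω => (X ω, A ω)) (g := R) hRmeas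
      subst hreq
      exact ⟨fun z => g (r z, z.2), hg.comp (hr.prodMk measurable_snd), fun z => hg01 _, hPg, rfl⟩
  · have : IsProbabilityMeasure (μ.map (fun ω => (R ω, A ω))) :=
      Measure.isProbabilityMeasure_map hRA.aemeasurable
    have hK := isCompact_moments (μ.map (fun ω => (R ω, A ω)))
      (fun i : Bool × Bool => cellW i.1 i.2) (fun i => measurable_cellW _ _)
      (fun i => abs_cellW_le _ _)
    have hv : ∀ g : ℝ × Bool → ℝ, Measurable g → (∀ z, g z ∈ Set.Icc (0:ℝ) 1) →
        ∀ i : Bool × Bool, ∫ ω in {ω | A ω = i.1 ∧ Y ω = i.2}, g (R ω, A ω) ∂μ =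
          ∫ z, g z * cellW i.1 i.2 z ∂(μ.map (fun ω => (R ω, A ω))) := by
      intro g hg hg01 i
      rw [cell (fun ω => g (R ω, A ω)) (hg.comp hRAm) (fun ω => hg01 _) i]
      exact (integral_map hRA.aemeasurable
        (hg.mul (measurable_cellW i.1 i.2)).aestronglyMeasurable).symm
    obtain ⟨v, ⟨⟨g, hg, hg01, hgv⟩, hvC⟩, hmin⟩ :=
      (hK.inter_right hC).exists_isMinOn
        ⟨0, ⟨fun _ => 0, measurable_const, by simp, by simp⟩, h0C⟩ hF.continuousOn
    have hgv' : (fun i : Bool × Bool =>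
        ∫ ω in {ω | A ω = i.1 ∧ Y ω = i.2}, g (R ω, A ω) ∂μ) = v := by
      funext i; rw [hv g hg hg01, hgv]
    refine ⟨g, hg, hg01, ?_, ?_⟩
    · rw [hP, hgv']; exact hvC
    · intro f hf hf01 hPf
      obtain ⟨g', hg', hg01', h⟩ := proj f hf hf01
      rw [hl (fun ω => f (X ω, A ω)) (hf.comp hXA) (fun ω => hf01 _), hl (fun ω => g (R ω, A ω)) (hg.comp hRA) (fun ω => hg01 _), hgv']
      rw [hP] at hPf
      exact hmin ⟨⟨g', hg', hg01', fun i => by rw [← hv g' hg' hg01' i]; exact congrFun h i⟩, hPf⟩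

/-- Let `R` be a version of `E[Y ∣ σ(X,A)]` (Bayes optimal
regressor). A randomized predictor with acceptance probability `p : Ω → [0,1]`
satisfies equalized odds iff `E[p ∣ A=a, Y=y]` does not depend on `a`, and equal
opportunity iff this holds for `y = 1`. The infimum of the expected loss over
randomized predictors `f(X,A)` satisfying equalized odds equals the infimum over
predictors `g(R,A)` derived from `(R,A)` satisfying equalized odds, and an optimal
equalized odds predictor can be derived from `(R,A)`; the same holds for equal
opportunity. -/
theorem optimal_equalized_odds_derived_from_bayes_regressor
    {Ω β : Type*} [MeasurableSpace Ω] [MeasurableSpace β]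
    (μ : Measure Ω) [IsProbabilityMeasure μ]
    (Y : Ω → Bool) (X : Ω → β) (A : Ω → Bool) (R : Ω → ℝ)
    (hY : Measurable Y) (hX : Measurable X) (hA : Measurable A)
    (hRmeas : Measurable[pairSigma X A] R)
    (hR : R =ᵐ[μ] μ[fun ω => if Y ω then (1:ℝ) else 0 | pairSigma X A])
    (hpos : ∀ a y : Bool, μ {ω | A ω = a ∧ Y ω = y} ≠ 0)
    (L : Bool → Bool → ℝ) :
    let cm : (Ω → ℝ) → Bool → Bool → ℝ := fun p a y =>
      ∫ ω, p ω ∂(μ[|{ω | A ω = a ∧ Y ω = y}])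
    let EqOdds : (Ω → ℝ) → Prop := fun p => ∀ y : Bool, cm p false y = cm p true y
    let EqOpp : (Ω → ℝ) → Prop := fun p => cm p false true = cm p true true
    let loss : (Ω → ℝ) → ℝ := fun p =>
      ∫ ω, (p ω * L true (Y ω) + (1 - p ω) * L false (Y ω)) ∂μ
    (sInf {l : ℝ | ∃ f : β × Bool → ℝ, Measurable f ∧ (∀ z, f z ∈ Set.Icc (0:ℝ) 1) ∧
          EqOdds (fun ω => f (X ω, A ω)) ∧ l = loss (fun ω => f (X ω, A ω))} =
        sInf {l : ℝ | ∃ g : ℝ × Bool → ℝ, Measurable g ∧ (∀ z, g z ∈ Set.Icc (0:ℝ) 1) ∧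
          EqOdds (fun ω => g (R ω, A ω)) ∧ l = loss (fun ω => g (R ω, A ω))}) ∧
      (∃ g : ℝ × Bool → ℝ, Measurable g ∧ (∀ z, g z ∈ Set.Icc (0:ℝ) 1) ∧
        EqOdds (fun ω => g (R ω, A ω)) ∧
        ∀ f : β × Bool → ℝ, Measurable f → (∀ z, f z ∈ Set.Icc (0:ℝ) 1) →
          EqOdds (fun ω => f (X ω, A ω)) →
          loss (fun ω => g (R ω, A ω)) ≤ loss (fun ω => f (X ω, A ω))) ∧
      (sInf {l : ℝ | ∃ f : β × Bool → ℝ, Measurable f ∧ (∀ z, f z ∈ Set.Icc (0:ℝ) 1) ∧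
          EqOpp (fun ω => f (X ω, A ω)) ∧ l = loss (fun ω => f (X ω, A ω))} =
        sInf {l : ℝ | ∃ g : ℝ × Bool → ℝ, Measurable g ∧ (∀ z, g z ∈ Set.Icc (0:ℝ) 1) ∧
          EqOpp (fun ω => g (R ω, A ω)) ∧ l = loss (fun ω => g (R ω, A ω))}) ∧
      (∃ g : ℝ × Bool → ℝ, Measurable g ∧ (∀ z, g z ∈ Set.Icc (0:ℝ) 1) ∧
        EqOpp (fun ω => g (R ω, A ω)) ∧
        ∀ f : β × Bool → ℝ, Measurable f → (∀ z, f z ∈ Set.Icc (0:ℝ) 1) →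
          EqOpp (fun ω => f (X ω, A ω)) →
          loss (fun ω => g (R ω, A ω)) ≤ loss (fun ω => f (X ω, A ω))) := by
  intro cm EqOdds EqOpp loss
  have hcm : ∀ p a y, cm p a y = (μ {ω | A ω = a ∧ Y ω = y})⁻¹.toReal *
      ∫ ω in {ω | A ω = a ∧ Y ω = y}, p ω ∂μ := by
    intro p a y
    simp only [cm, ProbabilityTheory.cond]
    rw [integral_smul_measure, smul_eq_mul]
  let c : Bool → Bool → ℝ := fun a y => (μ {ω | A ω = a ∧ Y ω = y})⁻¹.toReal
  let F : (Bool × Bool → ℝ) → ℝ := fun v =>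
    ∑ i : Bool × Bool, ((L true i.2 - L false i.2) * v i
        + L false i.2 * μ.real {ω | A ω = i.1 ∧ Y ω = i.2})
  have hF : Continuous F := by fun_prop
  have hl := fun p hp hp01 => loss_eq μ Y A hY hA L p hp hp01
  have h1 := general_derived μ Y X A R hY hX hA hRmeas hR EqOdds loss
    {v | ∀ y, c false y * v (false, y) = c true y * v (true, y)}
    (by
      simp only [Set.setOf_forall]
      exact isClosed_iInter fun y => isClosed_eq (by fun_prop) (by fun_prop))
    (by simp) F hF
    (fun p => by simp only [EqOdds, hcm]; rfl) hl
  have h2 := general_derived μ Y X A R hY hX hA hRmeas hR EqOpp loss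
    {v | c false true * v (false, true) = c true true * v (true, true)}
    (isClosed_eq (by fun_prop) (by fun_prop))
    (by simp) F hF
    (fun p => by simp only [EqOpp, hcm]; rfl) hl
  exact ⟨h1.1, h1.2, h2.1, h2.2⟩
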